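/- arXiv:2010.05018 — 3 statements merged into one kernel-verified Lean document; each statement's English description precedes it below -/
import Mathlib

section
/- For all real numbers q ∈ (0,1), γ·q/(1−q) + log(1−q)/log(q) < T(q) < q/(1−q) + log(1−q)/log(q), where γ is the Euler–Mascheroni constant. -/
/-- `d k = ` number of positive divisors of `k` -/
noncomputable def numDivisors (k : ℕ) : ℕ := k.divisors.card

/-- `T q = ∑_{k=1}^∞ d(k) q^k` (the `k = 0` term vanishes since `d 0 = 0`). -/
noncomputable def T (q : ℝ) : ℝ := ∑' k : ℕ, (numDivisors k : ℝ) * q ^ k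

open Real Set Filter Topology MeasureTheory

/-- The kernel `1 / (1 - e⁻ʸ) - 1 / y`. -/
noncomputable def gammaKernel (y : ℝ) : ℝ := (1 - exp (-y))⁻¹ - y⁻¹

lemma one_sub_exp_neg_pos {y : ℝ} (hy : 0 < y) : 0 < 1 - exp (-y) := by
  simpa using hy

lemma gammaKernel_pos {y : ℝ} (hy : 0 < y) : 0 < gammaKernel y := by
  have h := add_one_lt_exp (neg_ne_zero.2 hy.ne')
  exact sub_pos.2 (inv_strictAnti₀ (one_sub_exp_neg_pos hy) (by linarith))

lemma gammaKernel_nonneg {y : ℝ} (hy : 0 ≤ y) : 0 ≤ gammaKernel y := by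
  rcases hy.eq_or_lt with rfl | hy
  · simp [gammaKernel]
  · exact (gammaKernel_pos hy).le

lemma gammaKernel_lt_one {y : ℝ} (hy : 0 < y) : gammaKernel y < 1 := by
  have h := add_one_lt_exp hy.ne'
  have h1 := one_sub_exp_neg_pos hy
  have hE : exp y * exp (-y) = 1 := by rw [← exp_add]; simp
  rw [gammaKernel, sub_lt_iff_lt_add, inv_lt_iff_one_lt_mul₀ h1]
  have : (1 + y⁻¹) * (1 - exp (-y)) - 1 = y⁻¹ * exp (-y) * (exp y - (y + 1)) := by
    field_simp
    linear_combination -hE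
  have : 0 < y⁻¹ * exp (-y) * (exp y - (y + 1)) := by
    have := sub_pos.2 h
    positivity
  linarith

lemma hasDerivAt_one_sub_exp_neg (y : ℝ) :
    HasDerivAt (fun y : ℝ ↦ 1 - exp (-y)) (exp (-y)) y := by
  simpa using (hasDerivAt_neg y).exp.const_sub 1

lemma hasDerivAt_gammaKernel {y : ℝ} (hy : 0 < y) :
    HasDerivAt gammaKernel (-exp (-y) / (1 - exp (-y)) ^ 2 + (y ^ 2)⁻¹) y := by
  have := ((hasDerivAt_one_sub_exp_neg y).inv (one_sub_exp_neg_pos hy).ne').sub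
    (hasDerivAt_inv hy.ne')
  convert! this using 1
  ring

lemma continuousOn_gammaKernel : ContinuousOn gammaKernel (Ioi 0) :=
  fun _ hy ↦ (hasDerivAt_gammaKernel hy).continuousAt.continuousWithinAt

lemma strictMonoOn_gammaKernel : StrictMonoOn gammaKernel (Ioi 0) := by
  refine strictMonoOn_of_deriv_pos (convex_Ioi 0) continuousOn_gammaKernel fun y hy ↦ ?_
  rw [interior_Ioi] at hy
  have hy : 0 < y := hy
  rw [(hasDerivAt_gammaKernel hy).deriv]
  have h1 := one_sub_exp_neg_pos hy
  have hs : y < exp (y / 2) - exp (-(y / 2)) := by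
    have := self_lt_sinh_iff.2 (half_pos hy)
    rw [sinh_eq] at this
    linarith
  have hprod : 1 - exp (-y) = exp (-(y / 2)) * (exp (y / 2) - exp (-(y / 2))) := by
    rw [mul_sub, ← exp_add, ← exp_add, neg_add_cancel, exp_zero, ← neg_add, add_halves]
  have hsq : exp (-y) = exp (-(y / 2)) ^ 2 := by
    rw [← exp_nat_mul]
    ring_nf
  have hlt : y ^ 2 * exp (-y) < (1 - exp (-y)) ^ 2 := by
    rw [hprod, mul_pow, ← hsq, mul_comm]
    gcongr
  have : -exp (-y) / (1 - exp (-y)) ^ 2 + (y ^ 2)⁻¹ =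
      ((1 - exp (-y)) ^ 2 - y ^ 2 * exp (-y)) / ((1 - exp (-y)) ^ 2 * y ^ 2) := by
    field_simp
    ring
  rw [this]
  have := sub_pos.2 hlt
  positivity

lemma integrableOn_exp_neg_mul_gammaKernel :
    IntegrableOn (fun y ↦ exp (-y) * gammaKernel y) (Ioi 0) := by
  refine (integrableOn_exp_neg_Ioi 0).mono'
    (ContinuousOn.aestronglyMeasurable
      ((by fun_prop : ContinuousOn (fun y : ℝ ↦ exp (-y)) (Ioi 0)).mul continuousOn_gammaKernel)
      measurableSet_Ioi)
    ((ae_restrict_mem measurableSet_Ioi).mono fun y hy ↦ ?_)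
  rw [norm_mul, norm_of_nonneg (exp_pos _).le, norm_of_nonneg (gammaKernel_pos hy).le]
  exact mul_le_of_le_one_right (exp_pos _).le (gammaKernel_lt_one hy).le

lemma integral_log_mul_exp_neg :
    ∫ y in Ioi (0 : ℝ), log y * exp (-y) = -eulerMascheroniConstant := by
  have h := Complex.hasDerivAt_GammaIntegral (s := 1) (by simp)
  have h' : Complex.GammaIntegral =ᶠ[𝓝 1] Complex.Gamma := by
    filter_upwards [(isOpen_lt continuous_const Complex.continuous_re).mem_nhds
      (show (0 : ℝ) < (1 : ℂ).re by simp)] with s hs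
    exact (Complex.Gamma_eq_integral hs).symm
  have := (h.congr_of_eventuallyEq h'.symm).unique Complex.hasDerivAt_Gamma_one
  simp only [sub_self, Complex.cpow_zero, one_mul, ← Complex.ofReal_mul] at this
  rw [integral_complex_ofReal] at this
  exact_mod_cast this

lemma integrableOn_log_mul_exp_neg :
    IntegrableOn (fun y ↦ log y * exp (-y)) (Ioi 0) := by
  by_contra h
  have := integral_log_mul_exp_neg
  rw [integral_undef h] at this
  linarith [one_half_lt_eulerMascheroniConstant]

lemma tendsto_one_sub_exp_neg_div :
    Tendsto (fun y : ℝ ↦ (1 - exp (-y)) / y) (𝓝[>] 0) (𝓝 1) := by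
  have h := (hasDerivAt_one_sub_exp_neg 0).tendsto_slope_zero_right
  simpa [div_eq_inv_mul] using h

lemma integral_exp_neg_mul_gammaKernel :
    ∫ y in Ioi (0 : ℝ), exp (-y) * gammaKernel y = eulerMascheroniConstant := by
  have hd : ∀ y ∈ Ioi (0 : ℝ), HasDerivAt (fun y ↦ log (1 - exp (-y)) - exp (-y) * log y)
      (exp (-y) * gammaKernel y + log y * exp (-y)) y := fun y hy ↦ by
    have hy : 0 < y := hy
    have := ((hasDerivAt_one_sub_exp_neg y).log (one_sub_exp_neg_pos hy).ne').sub
      ((hasDerivAt_neg y).exp.mul (hasDerivAt_log hy.ne'))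
    convert! this using 1
    rw [gammaKernel]
    ring
  have hc : ContinuousWithinAt (fun y ↦ log (1 - exp (-y)) - exp (-y) * log y) (Ici 0) 0 := by
    rw [← continuousWithinAt_Ioi_iff_Ici, ContinuousWithinAt]
    have h1 := tendsto_one_sub_exp_neg_div.log one_ne_zero
    have h2 := tendsto_one_sub_exp_neg_div.mul
      (continuous_mul_log.continuousWithinAt (s := Ioi 0) (x := 0)).tendsto
    have h3 := h1.add h2
    simp only [log_one, zero_mul, mul_zero, add_zero] at h3
    simp only [neg_zero, exp_zero, sub_self, log_zero, mul_zero]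
    refine h3.congr' ?_
    filter_upwards [self_mem_nhdsWithin] with y hy
    have hy : 0 < y := hy
    rw [log_div (one_sub_exp_neg_pos hy).ne' hy.ne']
    field_simp
    ring
  have hl : Tendsto (fun y ↦ log (1 - exp (-y)) - exp (-y) * log y) atTop (𝓝 0) := by
    have h1 : Tendsto (fun y : ℝ ↦ log (1 - exp (-y))) atTop (𝓝 0) := by
      simpa using (tendsto_exp_neg_atTop_nhds_zero.const_sub 1).log (by simp)
    have h2 : Tendsto (fun y : ℝ ↦ exp (-y) * log y) atTop (𝓝 0) := by
      refine tendsto_of_tendsto_of_tendsto_of_le_of_le' tendsto_const_nhds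
        (by simpa using tendsto_pow_mul_exp_neg_atTop_nhds_zero 1) ?_ ?_
      · filter_upwards [eventually_ge_atTop 1] with y hy
        exact mul_nonneg (exp_pos _).le (log_nonneg hy)
      · filter_upwards [eventually_ge_atTop 1] with y hy
        rw [mul_comm]
        gcongr
        exact log_le_self (by linarith)
    simpa using h1.sub h2
  have := integral_Ioi_of_hasDerivAt_of_tendsto hc hd
    (integrableOn_exp_neg_mul_gammaKernel.add integrableOn_log_mul_exp_neg) hl
  rw [integral_add integrableOn_exp_neg_mul_gammaKernel integrableOn_log_mul_exp_neg,
    integral_log_mul_exp_neg] at this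
  simp at this
  linarith

lemma intervalIntegrable_exp_neg_mul_gammaKernel {a b : ℝ} (ha : 0 ≤ a) (hab : a ≤ b) :
    IntervalIntegrable (fun y ↦ exp (-y) * gammaKernel y) volume a b :=
  (intervalIntegrable_iff_integrableOn_Ioc_of_le hab).2
    (integrableOn_exp_neg_mul_gammaKernel.mono_set fun _ hy ↦ ha.trans_lt hy.1)

lemma intervalIntegral_exp_neg_mul_gammaKernel_lt {a b : ℝ} (ha : 0 ≤ a) (hab : a < b) :
    ∫ y in a..b, exp (-y) * gammaKernel y < (exp (-a) - exp (-b)) * gammaKernel b := by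
  have hi := intervalIntegrable_exp_neg_mul_gammaKernel ha hab.le
  have hc : IntervalIntegrable (fun y ↦ exp (-y) * gammaKernel b) volume a b :=
    Continuous.intervalIntegrable (by fun_prop) _ _
  have h := intervalIntegral.intervalIntegral_pos_of_pos_on (hc.sub hi) (fun y hy ↦
    sub_pos.2 (mul_lt_mul_of_pos_left (strictMonoOn_gammaKernel (ha.trans_lt hy.1)
      (ha.trans_lt hab) hy.2) (exp_pos _))) hab
  rw [intervalIntegral.integral_sub hc hi, intervalIntegral.integral_mul_const] at h
  have he : ∫ y in a..b, exp (-y) = exp (-a) - exp (-b) := by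
    rw [intervalIntegral.integral_comp_neg (fun y ↦ exp y), integral_exp]
  rw [he] at h
  linarith

lemma hasSum_intervalIntegral_exp_neg_mul_gammaKernel {t : ℝ} (ht : 0 < t) :
    HasSum (fun n : ℕ ↦ ∫ y in (n * t)..((n + 1 : ℕ) * t), exp (-y) * gammaKernel y)
      eulerMascheroniConstant := by
  have hle (n : ℕ) : n * t ≤ (n + 1 : ℕ) * t := by gcongr; simp
  rw [hasSum_iff_tendsto_nat_of_nonneg, ← integral_exp_neg_mul_gammaKernel]
  · have hsum (N : ℕ) := intervalIntegral.sum_integral_adjacent_intervals (μ := volume)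
      (a := fun n : ℕ ↦ n * t) (n := N) fun k _ ↦
        intervalIntegrable_exp_neg_mul_gammaKernel (by positivity) (hle k)
    simp only [hsum, Nat.cast_zero, zero_mul]
    exact intervalIntegral_tendsto_integral_Ioi 0 integrableOn_exp_neg_mul_gammaKernel
      (tendsto_natCast_atTop_atTop.atTop_mul_const ht)
  · intro n
    refine intervalIntegral.integral_nonneg (hle n) fun y hy ↦
      mul_nonneg (exp_pos _).le (gammaKernel_nonneg ?_)
    exact le_trans (by positivity) hy.1

lemma T_eq_tsum {q : ℝ} (hq : q ∈ Ioo (0 : ℝ) 1) :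
    T q = ∑' n : ℕ, q ^ (n + 1) / (1 - q ^ (n + 1)) := by
  have h := tsum_pow_div_one_sub_eq_tsum_sigma
    (show ‖q‖ < 1 by rw [norm_of_nonneg hq.1.le]; exact hq.2) 0
  simp only [pow_zero, one_mul, ArithmeticFunction.sigma_zero_apply] at h
  rw [tsum_pnat_eq_tsum_succ (f := fun n : ℕ ↦ q ^ n / (1 - q ^ n))] at h
  rw [h, T]
  refine (PNat.coe_injective.tsum_eq fun n hn ↦ ?_).symm
  rcases n.eq_zero_or_pos with rfl | h0
  · simp [numDivisors] at hn
  · exact ⟨⟨n, h0⟩, rfl⟩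

lemma hasSum_pow_mul_gammaKernel {q : ℝ} (hq : q ∈ Ioo (0 : ℝ) 1) :
    HasSum (fun n : ℕ ↦ q ^ (n + 1) * gammaKernel ((n + 1 : ℕ) * -log q))
      (T q - log (1 - q) / log q) := by
  have ht : 0 < -log q := neg_pos.2 (log_neg hq.1 hq.2)
  have hpos (n : ℕ) : 0 < ((n + 1 : ℕ) : ℝ) * -log q := by positivity
  have hs : Summable fun n : ℕ ↦ q ^ (n + 1) * gammaKernel ((n + 1 : ℕ) * -log q) := by
    refine Summable.of_nonneg_of_le
      (fun n ↦ mul_nonneg (pow_nonneg hq.1.le _) (gammaKernel_pos (hpos n)).le)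
      (fun n ↦ mul_le_of_le_one_right (pow_nonneg hq.1.le _) (gammaKernel_lt_one (hpos n)).le)
      ((summable_nat_add_iff 1).2 (summable_geometric_of_lt_one hq.1.le hq.2))
  have hl := (hasSum_pow_div_log_of_abs_lt_one
    (show |q| < 1 by rw [abs_of_pos hq.1]; exact hq.2)).div_const (-log q)
  rw [neg_div_neg_eq] at hl
  have hT := (hs.hasSum.add hl).tsum_eq
  have hterm (n : ℕ) : q ^ (n + 1) * gammaKernel ((n + 1 : ℕ) * -log q) +
      q ^ (n + 1) / (n + 1) / -log q = q ^ (n + 1) / (1 - q ^ (n + 1)) := by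
    have he : exp (-(((n + 1 : ℕ) : ℝ) * -log q)) = q ^ (n + 1) := by
      rw [mul_neg, neg_neg, exp_nat_mul, exp_log hq.1]
    rw [gammaKernel, he, mul_inv]
    push_cast
    ring
  simp only [hterm, ← T_eq_tsum hq] at hT
  rw [hT, add_sub_cancel_right]
  exact hs.hasSum

/-- For `q ∈ (0,1)`:
`γ q/(1-q) + log(1-q)/log q < T q < q/(1-q) + log(1-q)/log q`. -/
theorem T_bounds (q : ℝ) (hq : q ∈ Set.Ioo (0 : ℝ) 1) :
    Real.eulerMascheroniConstant * (q / (1 - q)) + Real.log (1 - q) / Real.log q < T q ∧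
      T q < q / (1 - q) + Real.log (1 - q) / Real.log q := by
  have ht : 0 < -log q := neg_pos.2 (log_neg hq.1 hq.2)
  have hpos (n : ℕ) : 0 < ((n + 1 : ℕ) : ℝ) * -log q := by positivity
  have h1q : 0 < 1 - q := sub_pos.2 hq.2
  have hS := hasSum_pow_mul_gammaKernel hq
  constructor
  · have he (n : ℕ) : exp (-((n : ℝ) * -log q)) = q ^ n := by
      rw [mul_neg, neg_neg, exp_nat_mul, exp_log hq.1]
    have hlt (n : ℕ) : q / (1 - q) * ∫ y in (n * -log q)..((n + 1 : ℕ) * -log q),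
        exp (-y) * gammaKernel y < q ^ (n + 1) * gammaKernel ((n + 1 : ℕ) * -log q) := by
      have h := intervalIntegral_exp_neg_mul_gammaKernel_lt (a := n * -log q)
        (b := (n + 1 : ℕ) * -log q) (by positivity) (by gcongr; simp)
      rw [he, he] at h
      calc _ < q / (1 - q) * ((q ^ n - q ^ (n + 1)) * gammaKernel ((n + 1 : ℕ) * -log q)) :=
            mul_lt_mul_of_pos_left h (div_pos hq.1 h1q)
        _ = _ := by field_simp; ring
    have := hasSum_lt (fun n ↦ (hlt n).le) (hlt 0)
      ((hasSum_intervalIntegral_exp_neg_mul_gammaKernel ht).mul_left (q / (1 - q))) hS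
    linarith
  · have hg : HasSum (fun n : ℕ ↦ q ^ (n + 1)) (q / (1 - q)) := by
      simpa [pow_succ', div_eq_mul_inv] using
        (hasSum_geometric_of_lt_one hq.1.le hq.2).mul_left q
    have hlt (n : ℕ) : q ^ (n + 1) * gammaKernel ((n + 1 : ℕ) * -log q) < q ^ (n + 1) :=
      mul_lt_of_lt_one_right (pow_pos hq.1 _) (gammaKernel_lt_one (hpos n))
    have := hasSum_lt (fun n ↦ (hlt n).le) (hlt 0) hS hg
    linarith
end

section
/- For all real numbers q ∈ (0,1), γ·q/(1−q)² + log(1−q)/((1−q)·log(q)) < ∑_{k=1}^∞ (∑_{j=1}^k d(j)) q^k < q/(1−q)² + log(1−q)/((1−q)·log(q)), where γ is the Euler–Mascheroni constant. -/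
open Filter Topology MeasureTheory Set

/-- The function `1 / (1 - e⁻ˣ) - 1 / x`, whose average against the exponential law is `γ`. -/
noncomputable def binetKernel (x : ℝ) : ℝ := 1 / (1 - Real.exp (-x)) - 1 / x

lemma one_sub_exp_neg_pos_s6 {x : ℝ} (hx : 0 < x) : 0 < 1 - Real.exp (-x) := by
  simpa using hx

lemma binetKernel_nonneg {x : ℝ} (hx : 0 < x) : 0 ≤ binetKernel x := by
  have h := one_sub_exp_neg_pos_s6 hx
  have h' : 1 - Real.exp (-x) ≤ x := by linarith [Real.add_one_le_exp (-x)]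
  exact sub_nonneg.2 (one_div_le_one_div_of_le h h')

lemma binetKernel_lt_one {x : ℝ} (hx : 0 < x) : binetKernel x < 1 := by
  have h := one_sub_exp_neg_pos_s6 hx
  have h1 : Real.exp (-x) * Real.exp x = 1 := by rw [← Real.exp_add]; simp
  have h2 := Real.add_one_lt_exp hx.ne'
  have h3 : Real.exp (-x) * (x + 1) < 1 := by
    exact (mul_lt_mul_of_pos_left h2 (Real.exp_pos _)).trans_eq h1
  unfold binetKernel
  rw [div_sub_div _ _ h.ne' hx.ne', div_lt_one (mul_pos h hx)]
  nlinarith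

lemma hasDerivAt_binetKernel {x : ℝ} (hx : 0 < x) :
    HasDerivAt binetKernel
      (-Real.exp (-x) / (1 - Real.exp (-x)) ^ 2 + 1 / x ^ 2) x := by
  have h := one_sub_exp_neg_pos_s6 hx
  have h1 : HasDerivAt (fun y : ℝ => 1 - Real.exp (-y)) (Real.exp (-x)) x := by
    simpa using ((hasDerivAt_neg x).exp).const_sub 1
  have h2 := (h1.inv h.ne').sub (hasDerivAt_inv hx.ne')
  refine (h2.congr_deriv ?_).congr_of_eventuallyEq (Eventually.of_forall fun y => ?_)
  · simp
  · simp [binetKernel]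

lemma strictMonoOn_binetKernel : StrictMonoOn binetKernel (Ioi 0) := by
  refine strictMonoOn_of_deriv_pos (convex_Ioi 0)
    (fun x hx => (hasDerivAt_binetKernel hx).continuousAt.continuousWithinAt) fun x hx => ?_
  rw [interior_Ioi] at hx
  have hx : 0 < x := hx
  rw [(hasDerivAt_binetKernel hx).deriv]
  have h := one_sub_exp_neg_pos_s6 hx
  have hs : x / 2 < Real.sinh (x / 2) := Real.self_lt_sinh_iff.2 (by positivity)
  rw [Real.sinh_eq] at hs
  have he : Real.exp (-x) = Real.exp (-(x / 2)) ^ 2 := by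
    rw [← Real.exp_nat_mul]; congr 1; push_cast; ring
  have h1 : Real.exp (-(x / 2)) * Real.exp (x / 2) = 1 := by rw [← Real.exp_add]; simp
  have hp := Real.exp_pos (-(x / 2))
  have key : x * Real.exp (-(x / 2)) < 1 - Real.exp (-x) := by
    rw [he]; nlinarith
  have key2 : x ^ 2 * Real.exp (-x) < (1 - Real.exp (-x)) ^ 2 := by
    have := pow_lt_pow_left₀ key (by positivity) two_ne_zero
    rwa [mul_pow, ← he] at this
  have : Real.exp (-x) / (1 - Real.exp (-x)) ^ 2 < 1 / x ^ 2 := by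
    rw [div_lt_div_iff₀ (by positivity) (by positivity)]; linarith
  rw [neg_div]; linarith

lemma integral_log_mul_exp_neg_s6 :
    ∫ t in Ioi (0 : ℝ), Real.log t * Real.exp (-t) = -Real.eulerMascheroniConstant := by
  have h1 := Complex.hasDerivAt_GammaIntegral (s := 1) (by simp)
  have h2 : HasDerivAt Complex.GammaIntegral (-(Real.eulerMascheroniConstant : ℂ)) 1 := by
    refine Complex.hasDerivAt_Gamma_one.congr_of_eventuallyEq ?_
    have : ∀ᶠ s : ℂ in 𝓝 1, 0 < s.re :=
      (isOpen_lt continuous_const Complex.continuous_re).mem_nhds (by simp)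
    filter_upwards [this] with s hs using (Complex.Gamma_eq_integral hs).symm
  have h3 := h1.unique h2
  simp only [sub_self, Complex.cpow_zero, one_mul] at h3
  have h4 : (∫ t in Ioi (0 : ℝ), ((Real.log t : ℂ) * (Real.exp (-t) : ℂ))) =
      ((∫ t in Ioi (0 : ℝ), Real.log t * Real.exp (-t) : ℝ) : ℂ) := by
    rw [← integral_complex_ofReal]; simp
  rw [h4] at h3
  exact_mod_cast h3

lemma integrableOn_log_mul_exp_neg_s6 :
    IntegrableOn (fun t : ℝ => Real.log t * Real.exp (-t)) (Ioi 0) := by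
  by_contra h
  have h1 := integral_log_mul_exp_neg_s6
  rw [integral_undef h] at h1
  linarith [Real.one_half_lt_eulerMascheroniConstant]

lemma integrableOn_exp_neg_mul_binetKernel :
    IntegrableOn (fun x : ℝ => Real.exp (-x) * binetKernel x) (Ioi 0) := by
  have hm : Measurable binetKernel := by unfold binetKernel; fun_prop
  refine (integrableOn_exp_neg_Ioi 0).mono' (by fun_prop) ?_
  refine (ae_restrict_iff' measurableSet_Ioi).2 (Eventually.of_forall fun x hx => ?_)
  rw [Real.norm_of_nonneg (mul_nonneg (Real.exp_pos _).le (binetKernel_nonneg hx))]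
  exact mul_le_of_le_one_right (Real.exp_pos _).le (binetKernel_lt_one hx).le

lemma tendsto_log_one_sub_exp_neg_sub_zero :
    Tendsto (fun x : ℝ => Real.log (1 - Real.exp (-x)) - Real.exp (-x) * Real.log x)
      (𝓝[>] 0) (𝓝 0) := by
  have h1 : HasDerivAt (fun y : ℝ => 1 - Real.exp (-y)) 1 0 := by
    simpa using ((hasDerivAt_neg (0 : ℝ)).exp).const_sub 1
  have hq : Tendsto (fun x : ℝ => (1 - Real.exp (-x)) / x) (𝓝[>] 0) (𝓝 1) := by
    have := h1.tendsto_slope_zero_right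
    simpa [div_eq_inv_mul] using this
  have hlog := hq.log one_ne_zero
  have hxl : Tendsto (fun x : ℝ => Real.log x * x) (𝓝[>] 0) (𝓝 0) := by
    simpa using tendsto_log_mul_rpow_nhdsGT_zero one_pos
  have hsum := hlog.add (hq.mul hxl)
  rw [Real.log_one, mul_zero, add_zero] at hsum
  refine hsum.congr' ?_
  filter_upwards [self_mem_nhdsWithin] with x hx
  have hx : 0 < x := hx
  rw [Real.log_div (one_sub_exp_neg_pos_s6 hx).ne' hx.ne']
  field_simp
  ring

lemma tendsto_log_one_sub_exp_neg_sub_atTop :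
    Tendsto (fun x : ℝ => Real.log (1 - Real.exp (-x)) - Real.exp (-x) * Real.log x)
      atTop (𝓝 0) := by
  have he : Tendsto (fun x : ℝ => Real.exp (-x)) atTop (𝓝 0) :=
    Real.tendsto_exp_neg_atTop_nhds_zero
  have h1 : Tendsto (fun x : ℝ => Real.log (1 - Real.exp (-x))) atTop (𝓝 0) := by
    simpa using (he.const_sub 1).log (by simp)
  have h2 : Tendsto (fun x : ℝ => x * Real.exp (-x)) atTop (𝓝 0) := by
    simpa using Real.tendsto_pow_mul_exp_neg_atTop_nhds_zero 1
  have h3 : Tendsto (fun x : ℝ => Real.exp (-x) * Real.log x) atTop (𝓝 0) := by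
    refine squeeze_zero' ?_ ?_ h2
    · filter_upwards [eventually_ge_atTop 1] with x hx
      exact mul_nonneg (Real.exp_pos _).le (Real.log_nonneg hx)
    · filter_upwards [eventually_ge_atTop 1] with x hx
      rw [mul_comm]
      exact mul_le_mul_of_nonneg_right (Real.log_le_self (by linarith)) (Real.exp_pos _).le
  simpa using h1.sub h3

lemma integral_exp_neg_mul_binetKernel :
    ∫ x in Ioi (0 : ℝ), Real.exp (-x) * binetKernel x = Real.eulerMascheroniConstant := by
  have hint := integrableOn_exp_neg_mul_binetKernel.add integrableOn_log_mul_exp_neg_s6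
  have hderiv : ∀ x ∈ Ioi (0 : ℝ), HasDerivAt
      (fun x : ℝ => Real.log (1 - Real.exp (-x)) - Real.exp (-x) * Real.log x)
      (Real.exp (-x) * binetKernel x + Real.log x * Real.exp (-x)) x := by
    intro x hx
    have hx : 0 < x := hx
    have h := one_sub_exp_neg_pos_s6 hx
    have he : HasDerivAt (fun y : ℝ => Real.exp (-y)) (-Real.exp (-x)) x := by
      simpa using (hasDerivAt_neg x).exp
    refine (((he.const_sub 1).log h.ne').sub (he.mul (Real.hasDerivAt_log hx.ne'))).congr_deriv ?_
    unfold binetKernel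
    field_simp
    ring
  have hcont : ContinuousWithinAt
      (fun x : ℝ => Real.log (1 - Real.exp (-x)) - Real.exp (-x) * Real.log x) (Ici 0) 0 := by
    rw [← Ioi_insert, continuousWithinAt_insert_self]
    simpa [ContinuousWithinAt] using tendsto_log_one_sub_exp_neg_sub_zero
  have hftc := integral_Ioi_of_hasDerivAt_of_tendsto hcont hderiv hint
    tendsto_log_one_sub_exp_neg_sub_atTop
  rw [integral_add integrableOn_exp_neg_mul_binetKernel integrableOn_log_mul_exp_neg_s6,
    integral_log_mul_exp_neg_s6] at hftc
  simp at hftc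
  linarith

lemma integral_exp_neg_interval (a b : ℝ) :
    ∫ x in a..b, Real.exp (-x) = Real.exp (-a) - Real.exp (-b) := by
  simp

lemma intervalIntegrable_exp_neg_mul_binetKernel {a b : ℝ} (ha : 0 ≤ a) (hab : a ≤ b) :
    IntervalIntegrable (fun x : ℝ => Real.exp (-x) * binetKernel x) volume a b :=
  (intervalIntegrable_iff_integrableOn_Ioc_of_le hab).2
    (integrableOn_exp_neg_mul_binetKernel.mono_set fun _ hx => ha.trans_lt hx.1)

lemma integral_exp_neg_mul_binetKernel_le {a b : ℝ} (ha : 0 ≤ a) (hab : a < b) :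
    ∫ x in a..b, Real.exp (-x) * binetKernel x ≤
      (Real.exp (-a) - Real.exp (-b)) * binetKernel b := by
  rw [← integral_exp_neg_interval, ← intervalIntegral.integral_mul_const]
  refine intervalIntegral.integral_mono_on_of_le_Ioo hab.le
    (intervalIntegrable_exp_neg_mul_binetKernel ha hab.le)
    (Continuous.intervalIntegrable (by fun_prop) _ _) fun x hx => ?_
  have hx0 : 0 < x := ha.trans_lt hx.1
  exact mul_le_mul_of_nonneg_left
    (strictMonoOn_binetKernel hx0 (hx0.trans hx.2) hx.2).le (Real.exp_pos _).le

lemma integral_exp_neg_mul_binetKernel_lt {a b : ℝ} (ha : 0 < a) (hab : a < b) :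
    ∫ x in a..b, Real.exp (-x) * binetKernel x <
      (Real.exp (-a) - Real.exp (-b)) * binetKernel b := by
  rw [← integral_exp_neg_interval, ← intervalIntegral.integral_mul_const]
  refine intervalIntegral.integral_lt_integral_of_continuousOn_of_le_of_exists_lt hab
    (fun x hx => ?_) (Continuous.continuousOn (by fun_prop)) (fun x hx => ?_)
    ⟨a, left_mem_Icc.2 hab.le, ?_⟩
  · have hx0 : 0 < x := ha.trans_le hx.1
    exact ((Real.continuous_exp.comp continuous_neg).continuousAt.mul
      (hasDerivAt_binetKernel hx0).continuousAt).continuousWithinAt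
  · have hx0 : 0 < x := ha.trans hx.1
    exact mul_le_mul_of_nonneg_left
      (strictMonoOn_binetKernel.monotoneOn hx0 (hx0.trans_le hx.2) hx.2) (Real.exp_pos _).le
  · exact mul_lt_mul_of_pos_left (strictMonoOn_binetKernel ha (ha.trans hab) hab) (Real.exp_pos _)

lemma hasSum_integral_exp_neg_mul_binetKernel {t : ℝ} (ht : 0 < t) :
    HasSum (fun n : ℕ => ∫ x in (n * t)..((n + 1 : ℕ) * t), Real.exp (-x) * binetKernel x)
      Real.eulerMascheroniConstant := by
  have hmono (n : ℕ) : (n : ℝ) * t ≤ ((n + 1 : ℕ) : ℝ) * t := by push_cast; nlinarith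
  have hnn (n : ℕ) : 0 ≤ (n : ℝ) * t := by positivity
  rw [hasSum_iff_tendsto_nat_of_nonneg]
  · have h (N : ℕ) : ∑ n ∈ Finset.range N,
        ∫ x in (n * t)..((n + 1 : ℕ) * t), Real.exp (-x) * binetKernel x =
        ∫ x in (0 : ℝ)..(N * t), Real.exp (-x) * binetKernel x := by
      rw [intervalIntegral.sum_integral_adjacent_intervals (a := fun n : ℕ => (n : ℝ) * t)
        fun n _ => intervalIntegrable_exp_neg_mul_binetKernel (hnn n) (hmono n)]
      simp
    simp_rw [h]
    rw [← integral_exp_neg_mul_binetKernel]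
    exact intervalIntegral_tendsto_integral_Ioi 0 integrableOn_exp_neg_mul_binetKernel
      (tendsto_natCast_atTop_atTop.atTop_mul_const ht)
  · intro n
    rw [intervalIntegral.integral_of_le (hmono n)]
    refine setIntegral_nonneg measurableSet_Ioc fun x hx => ?_
    exact mul_nonneg (Real.exp_pos _).le (binetKernel_nonneg ((hnn n).trans_lt hx.1))

lemma summable_pow_mul_binetKernel {q : ℝ} (hq : q ∈ Ioo (0 : ℝ) 1) {t : ℝ} (ht : 0 < t) :
    Summable fun n : ℕ => q ^ (n + 1) * binetKernel ((n + 1 : ℕ) * t) := by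
  have hpos (n : ℕ) : 0 < ((n + 1 : ℕ) : ℝ) * t := by positivity
  have hq0 := hq.1
  refine Summable.of_nonneg_of_le (fun n => ?_) (fun n => ?_)
    ((summable_nat_add_iff 1).2 (summable_geometric_of_lt_one hq.1.le hq.2))
  · exact mul_nonneg (by positivity) (binetKernel_nonneg (hpos n))
  · exact mul_le_of_le_one_right (by positivity) (binetKernel_lt_one (hpos n)).le

lemma tsum_pow_succ {q : ℝ} (hq : q ∈ Ioo (0 : ℝ) 1) :
    ∑' n : ℕ, q ^ (n + 1) = q / (1 - q) := by
  simp_rw [pow_succ']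
  rw [tsum_mul_left, tsum_geometric_of_lt_one hq.1.le hq.2, div_eq_mul_inv]

lemma tsum_pow_mul_binetKernel_lt {q : ℝ} (hq : q ∈ Ioo (0 : ℝ) 1) {t : ℝ} (ht : 0 < t) :
    ∑' n : ℕ, q ^ (n + 1) * binetKernel ((n + 1 : ℕ) * t) < q / (1 - q) := by
  have hpos (n : ℕ) : 0 < ((n + 1 : ℕ) : ℝ) * t := by positivity
  have hq0 := hq.1
  have h (n : ℕ) : q ^ (n + 1) * binetKernel ((n + 1 : ℕ) * t) < q ^ (n + 1) :=
    mul_lt_of_lt_one_right (by positivity) (binetKernel_lt_one (hpos n))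
  rw [← tsum_pow_succ hq]
  exact Summable.tsum_lt_tsum (i := 0) (fun n => (h n).le) (h 0)
    (summable_pow_mul_binetKernel hq ht)
    ((summable_nat_add_iff 1).2 (summable_geometric_of_lt_one hq.1.le hq.2))

lemma lt_tsum_pow_mul_binetKernel {q : ℝ} (hq : q ∈ Ioo (0 : ℝ) 1) :
    Real.eulerMascheroniConstant * (q / (1 - q)) <
      ∑' n : ℕ, q ^ (n + 1) * binetKernel ((n + 1 : ℕ) * -Real.log q) := by
  have ht : 0 < -Real.log q := neg_pos.2 (Real.log_neg hq.1 hq.2)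
  set t := -Real.log q with htq
  have hexp (n : ℕ) : Real.exp (-(n * t)) = q ^ n := by
    rw [htq, mul_neg, neg_neg, Real.exp_nat_mul, Real.exp_log hq.1]
  have hq1 : 0 < 1 - q := sub_pos.2 hq.2
  have hc : 0 < q / (1 - q) := div_pos hq.1 hq1
  have hscale (n : ℕ) : (Real.exp (-(n * t)) - Real.exp (-((n + 1 : ℕ) * t))) *
      binetKernel ((n + 1 : ℕ) * t) * (q / (1 - q)) =
      q ^ (n + 1) * binetKernel ((n + 1 : ℕ) * t) := by
    rw [hexp, hexp]
    field_simp
    ring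
  have hlt (n : ℕ) : (n : ℝ) * t < (n + 1 : ℕ) * t := by push_cast; linarith
  have hsum := (hasSum_integral_exp_neg_mul_binetKernel ht).mul_right (q / (1 - q))
  rw [← hsum.tsum_eq]
  refine Summable.tsum_lt_tsum (i := 1) (fun n => ?_) ?_ hsum.summable
    (summable_pow_mul_binetKernel hq ht)
  · rw [← hscale]
    exact mul_le_mul_of_nonneg_right
      (integral_exp_neg_mul_binetKernel_le (by positivity) (hlt n)) hc.le
  · rw [← hscale]
    exact mul_lt_mul_of_pos_right
      (integral_exp_neg_mul_binetKernel_lt (by simpa using ht) (hlt 1)) hc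

lemma summable_numDivisors_mul_pow {q : ℝ} (hq : q ∈ Ioo (0 : ℝ) 1) :
    Summable fun n : ℕ => (numDivisors n : ℝ) * q ^ n := by
  have hn : ‖q‖ < 1 := by rw [Real.norm_of_nonneg hq.1.le]; exact hq.2
  have hq0 := hq.1
  refine Summable.of_nonneg_of_le (fun n => by positivity) (fun n => ?_)
    (summable_pow_mul_geometric_of_norm_lt_one 1 hn)
  rw [pow_one]
  exact mul_le_mul_of_nonneg_right (by exact_mod_cast Nat.card_divisors_le_self n) (by positivity)

open ArithmeticFunction in
lemma tsum_numDivisors_mul_pow {q : ℝ} (hq : q ∈ Ioo (0 : ℝ) 1) :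
    ∑' n : ℕ, (numDivisors n : ℝ) * q ^ n = ∑' n : ℕ, q ^ (n + 1) / (1 - q ^ (n + 1)) := by
  have hn : ‖q‖ < 1 := by rw [Real.norm_of_nonneg hq.1.le]; exact hq.2
  have h := tsum_pow_div_one_sub_eq_tsum_sigma hn 0
  simp only [pow_zero, one_mul, sigma_zero_apply] at h
  rw [tsum_pnat_eq_tsum_succ (f := fun n : ℕ => q ^ n / (1 - q ^ n)),
    tsum_pnat_eq_tsum_succ (f := fun n : ℕ => (n.divisors.card : ℝ) * q ^ n)] at h
  rw [h, tsum_eq_zero_add' (f := fun n : ℕ => (numDivisors n : ℝ) * q ^ n)]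
  · simp [numDivisors]
  · exact (summable_nat_add_iff 1).2 (summable_numDivisors_mul_pow hq)

lemma tsum_sum_numDivisors_mul_pow {q : ℝ} (hq : q ∈ Ioo (0 : ℝ) 1) :
    ∑' k : ℕ, (∑ j ∈ Finset.Icc 1 k, (numDivisors j : ℝ)) * q ^ k =
      (∑' n : ℕ, (numDivisors n : ℝ) * q ^ n) * (1 - q)⁻¹ := by
  rw [← tsum_geometric_of_lt_one hq.1.le hq.2,
    tsum_mul_tsum_eq_tsum_sum_range_of_summable_norm (summable_numDivisors_mul_pow hq).norm
      (summable_geometric_of_lt_one hq.1.le hq.2).norm]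
  refine tsum_congr fun k => ?_
  rw [Finset.sum_mul, Finset.range_eq_Ico, Finset.sum_eq_sum_Ico_succ_bot (by lia)]
  have h0 : numDivisors 0 = 0 := by simp [numDivisors]
  rw [h0, Nat.cast_zero, zero_mul, zero_mul, zero_add, zero_add]
  refine Finset.sum_congr rfl fun j hj => ?_
  rw [mul_assoc, ← pow_add, Nat.add_sub_cancel' (Finset.mem_Icc.1 hj).2]

lemma tsum_pow_div_one_sub_pow {q : ℝ} (hq : q ∈ Ioo (0 : ℝ) 1) :
    ∑' n : ℕ, q ^ (n + 1) / (1 - q ^ (n + 1)) =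
      ∑' n : ℕ, q ^ (n + 1) * binetKernel ((n + 1 : ℕ) * -Real.log q) +
        Real.log (1 - q) / Real.log q := by
  have hlog : Real.log q < 0 := Real.log_neg hq.1 hq.2
  have hL := (Real.hasSum_pow_div_log_of_abs_lt_one
    (by rw [abs_of_pos hq.1]; exact hq.2 : |q| < 1)).mul_right (-Real.log q)⁻¹
  have hsum := (summable_pow_mul_binetKernel hq (neg_pos.2 hlog)).hasSum.add hL
  convert hsum.tsum_eq using 1
  · refine tsum_congr fun n => ?_
    have hexp : Real.exp (-(((n + 1 : ℕ) : ℝ) * -Real.log q)) = q ^ (n + 1) := by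
      rw [mul_neg, neg_neg, Real.exp_nat_mul, Real.exp_log hq.1]
    have hn : (n : ℝ) + 1 ≠ 0 := by positivity
    have hne := hlog.ne
    rw [binetKernel, hexp]
    push_cast
    field_simp
    ring
  · rw [inv_neg, neg_mul_neg, div_eq_mul_inv]

/-- For `q ∈ (0,1)`:
`γ q/(1-q)² + log(1-q)/((1-q) log q) < ∑_{k=1}^∞ (∑_{j=1}^k d(j)) q^k
  < q/(1-q)² + log(1-q)/((1-q) log q)`.
(The `k = 0` term of the `tsum` is an empty sum, hence `0`.) -/
theorem divisor_partial_sum_series_bounds (q : ℝ) (hq : q ∈ Set.Ioo (0 : ℝ) 1) :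
    Real.eulerMascheroniConstant * (q / (1 - q) ^ 2) +
        Real.log (1 - q) / ((1 - q) * Real.log q) <
        (∑' k : ℕ, (∑ j ∈ Finset.Icc 1 k, (numDivisors j : ℝ)) * q ^ k) ∧
      (∑' k : ℕ, (∑ j ∈ Finset.Icc 1 k, (numDivisors j : ℝ)) * q ^ k) <
        q / (1 - q) ^ 2 + Real.log (1 - q) / ((1 - q) * Real.log q) := by
  have hq1 : 0 < (1 - q)⁻¹ := inv_pos.2 (sub_pos.2 hq.2)
  have hlog : Real.log q < 0 := Real.log_neg hq.1 hq.2
  have hlower := mul_lt_mul_of_pos_right (lt_tsum_pow_mul_binetKernel hq) hq1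
  have hupper := mul_lt_mul_of_pos_right (tsum_pow_mul_binetKernel_lt hq (neg_pos.2 hlog)) hq1
  have hdiv : q / (1 - q) ^ 2 = q / (1 - q) * (1 - q)⁻¹ := by
    rw [div_eq_mul_inv, div_eq_mul_inv, pow_two, mul_inv, mul_assoc]
  have hdiv' : Real.log (1 - q) / ((1 - q) * Real.log q) =
      Real.log (1 - q) / Real.log q * (1 - q)⁻¹ := by
    rw [div_eq_mul_inv, div_eq_mul_inv, mul_inv, mul_comm (1 - q)⁻¹, mul_assoc]
  rw [tsum_sum_numDivisors_mul_pow hq, tsum_numDivisors_mul_pow hq, tsum_pow_div_one_sub_pow hq,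
    hdiv, hdiv', add_mul]
  constructor <;> linarith
end

section
/- For each q ∈ (0,1) there exists a real number N_q > 1 such that the function x ↦ φ_q(x) is strictly concave on [1, N_q] and strictly convex on [N_q, ∞). -/
/-- `φ_q(x) = q^x (q^x - qx + x - 1) / (1 - q^x)²`, with `q^x` the real power. -/
noncomputable def phi (q x : ℝ) : ℝ := q ^ x * (q ^ x - q * x + x - 1) / (1 - q ^ x) ^ 2

/-- The function `s ↦ s (2 + cosh s) / sinh s`, which governs the sign of `φ_q''`. -/
noncomputable def cothRatio (s : ℝ) : ℝ := s * (2 + Real.cosh s) / Real.sinh s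

theorem two_add_cosh_mul_sinh_gt {s : ℝ} (hs : 0 < s) :
    s * (1 + 2 * Real.cosh s) < (2 + Real.cosh s) * Real.sinh s := by
  have hd : ∀ x : ℝ, HasDerivAt
      (fun s => (2 + Real.cosh s) * Real.sinh s - s * (1 + 2 * Real.cosh s))
      (2 * Real.sinh x * (Real.sinh x - x)) x := by
    intro x
    have h := (((Real.hasDerivAt_cosh x).const_add 2).mul (Real.hasDerivAt_sinh x)).sub
      ((hasDerivAt_id x).mul (((Real.hasDerivAt_cosh x).const_mul 2).const_add 1))
    refine h.congr_deriv ?_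
    simp only [id]
    linear_combination Real.cosh_sq x
  have hmono : StrictMonoOn
      (fun s => (2 + Real.cosh s) * Real.sinh s - s * (1 + 2 * Real.cosh s)) (Set.Ici 0) := by
    refine strictMonoOn_of_deriv_pos (convex_Ici 0)
      (fun x _ => (hd x).continuousAt.continuousWithinAt) fun x hx => ?_
    rw [interior_Ici, Set.mem_Ioi] at hx
    rw [(hd x).deriv]
    exact mul_pos (mul_pos two_pos (Real.sinh_pos_iff.2 hx)) (sub_pos.2 (Real.self_lt_sinh_iff.2 hx))
  have h := hmono Set.self_mem_Ici hs.le hs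
  simp only [Real.sinh_zero, mul_zero, zero_mul, sub_zero] at h
  exact sub_pos.1 h

theorem hasDerivAt_cothRatio {s : ℝ} (hs : 0 < s) :
    HasDerivAt cothRatio
      (((2 + Real.cosh s) * Real.sinh s - s * (1 + 2 * Real.cosh s)) / Real.sinh s ^ 2) s := by
  have h := ((hasDerivAt_id s).mul ((Real.hasDerivAt_cosh s).const_add 2)).div
    (Real.hasDerivAt_sinh s) (Real.sinh_pos_iff.2 hs).ne'
  refine h.congr_deriv ?_
  simp only [id, Pi.mul_apply]
  congr 1
  linear_combination (-s) * Real.cosh_sq s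

theorem continuousOn_cothRatio : ContinuousOn cothRatio (Set.Ioi 0) := fun _ hs =>
  (hasDerivAt_cothRatio hs).continuousAt.continuousWithinAt

theorem strictMonoOn_cothRatio : StrictMonoOn cothRatio (Set.Ioi 0) := by
  refine strictMonoOn_of_deriv_pos (convex_Ioi 0) continuousOn_cothRatio fun s hs => ?_
  rw [interior_Ioi, Set.mem_Ioi] at hs
  rw [(hasDerivAt_cothRatio hs).deriv]
  exact div_pos (sub_pos.2 (two_add_cosh_mul_sinh_gt hs)) (pow_pos (Real.sinh_pos_iff.2 hs) 2)

theorem self_lt_cothRatio {s : ℝ} (hs : 0 < s) : s < cothRatio s := by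
  rw [cothRatio, lt_div_iff₀ (Real.sinh_pos_iff.2 hs)]
  exact mul_lt_mul_of_pos_left (by linarith [Real.sinh_lt_cosh s]) hs

theorem cothRatio_eq_exp (s : ℝ) :
    cothRatio s = s * (1 + 4 * Real.exp (-s) + Real.exp (-s) ^ 2) / (1 - Real.exp (-s) ^ 2) := by
  have he : Real.exp s * Real.exp (-s) = 1 := by rw [← Real.exp_add, add_neg_cancel, Real.exp_zero]
  have hn : (2 * Real.exp (-s)) ≠ 0 := by positivity
  rw [cothRatio, Real.cosh_eq, Real.sinh_eq, ← mul_div_mul_right _ _ hn]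
  congr 1
  · linear_combination s * he
  · linear_combination he

theorem one_sub_exp_mul_cothRatio_lt {L : ℝ} (hL : 0 < L) :
    (1 - Real.exp (-L)) * cothRatio L < 2 * (1 - Real.exp (-L)) + L := by
  have he : Real.exp L * Real.exp (-L) = 1 := by rw [← Real.exp_add, add_neg_cancel, Real.exp_zero]
  have hsinh := Real.self_lt_sinh_iff.2 hL
  rw [Real.sinh_eq] at hsinh
  rw [cothRatio_eq_exp]
  have h0 := Real.exp_pos (-L)
  have h1 : Real.exp (-L) < 1 := Real.exp_lt_one_iff.2 (neg_neg_of_pos hL)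
  set q := Real.exp (-L)
  have hLq : 2 * (L * q) < 1 - q ^ 2 := by nlinarith
  have hq : 1 - q ≠ 0 := by linarith
  have hq' : 0 < 1 + q := by linarith
  have : (1 - q) * (L * (1 + 4 * q + q ^ 2) / (1 - q ^ 2)) = L * (1 + 4 * q + q ^ 2) / (1 + q) := by
    rw [show 1 - q ^ 2 = (1 - q) * (1 + q) by ring]
    field_simp
  rw [this, div_lt_iff₀ hq']
  nlinarith [mul_pos hL h0]

theorem hasDerivAt_const_rpow {q : ℝ} (hq : 0 < q) (x : ℝ) :
    HasDerivAt (fun x => q ^ x) (Real.log q * q ^ x) x := by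
  simpa using (hasDerivAt_id x).const_rpow hq

theorem hasDerivAt_phi {q x : ℝ} (hq : q ∈ Set.Ioo (0 : ℝ) 1) (hx : 0 < x) :
    HasDerivAt (phi q)
      ((1 - q - Real.log q) * q ^ x / (1 - q ^ x) ^ 2
        + (1 - q) * x * Real.log q * (q ^ x * (1 + q ^ x)) / (1 - q ^ x) ^ 3) x := by
  have ht := hasDerivAt_const_rpow hq.1 x
  have hne : 1 - q ^ x ≠ 0 := (sub_pos.2 (Real.rpow_lt_one hq.1.le hq.2 hx)).ne'
  have h := (ht.mul (((ht.sub ((hasDerivAt_id x).const_mul q)).add (hasDerivAt_id x)).sub_const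
    1)).div ((ht.const_sub 1).pow 2) (pow_ne_zero 2 hne)
  refine h.congr_deriv ?_
  simp only [id, Pi.mul_apply, Pi.sub_apply, Pi.add_apply, Pi.pow_apply]
  field_simp
  ring

theorem hasDerivAt_deriv_phi {q x : ℝ} (hq : q ∈ Set.Ioo (0 : ℝ) 1) (hx : 0 < x) :
    HasDerivAt (deriv (phi q))
      (-Real.log q * q ^ x * (1 + q ^ x) / (1 - q ^ x) ^ 3 *
        ((1 - q) * cothRatio (-Real.log q * x) - (2 * (1 - q) - Real.log q))) x := by
  have ht := hasDerivAt_const_rpow hq.1 x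
  have ht0 : 0 < q ^ x := Real.rpow_pos_of_pos hq.1 x
  have ht1 : 0 < 1 - q ^ x := sub_pos.2 (Real.rpow_lt_one hq.1.le hq.2 hx)
  have h := ((ht.const_mul (1 - q - Real.log q)).div ((ht.const_sub 1).pow 2)
    (pow_ne_zero 2 ht1.ne')).add
    (((((hasDerivAt_id x).const_mul (1 - q)).mul_const (Real.log q)).mul
      (ht.mul (ht.const_add 1))).div ((ht.const_sub 1).pow 3) (pow_ne_zero 3 ht1.ne'))
  have hev : deriv (phi q) =ᶠ[nhds x] fun x => (1 - q - Real.log q) * q ^ x / (1 - q ^ x) ^ 2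
        + (1 - q) * x * Real.log q * (q ^ x * (1 + q ^ x)) / (1 - q ^ x) ^ 3 := by
    filter_upwards [lt_mem_nhds hx] with y hy using (hasDerivAt_phi hq hy).deriv
  refine (HasDerivAt.congr_of_eventuallyEq h hev).congr_deriv ?_
  have hexp : Real.exp (-(-Real.log q * x)) = q ^ x := by
    rw [Real.rpow_def_of_pos hq.1]; ring_nf
  rw [cothRatio_eq_exp, hexp, show 1 - (q ^ x) ^ 2 = (1 - q ^ x) * (1 + q ^ x) by ring]
  have hne := ht1.ne'
  have hne' : 1 + q ^ x ≠ 0 := by positivity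
  simp only [id, Pi.mul_apply, Pi.pow_apply]
  field_simp
  ring

/-- For each `q ∈ (0,1)` there is `N > 1` such that `φ_q` is strictly concave on `[1, N]`
and strictly convex on `[N, ∞)`. -/
theorem phi_concave_convex (q : ℝ) (hq : q ∈ Set.Ioo (0 : ℝ) 1) :
    ∃ N : ℝ, 1 < N ∧ StrictConcaveOn ℝ (Set.Icc (1 : ℝ) N) (phi q) ∧
      StrictConvexOn ℝ (Set.Ici N) (phi q) := by
  have hL : 0 < -Real.log q := neg_pos.2 (Real.log_neg hq.1 hq.2)
  have hb : 0 < 1 - q := sub_pos.2 hq.2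
  have hexp : Real.exp (-(-Real.log q)) = q := by rw [neg_neg, Real.exp_log hq.1]
  set c := (2 * (1 - q) - Real.log q) / (1 - q) with hc
  have hbc : (1 - q) * c = 2 * (1 - q) - Real.log q := mul_div_cancel₀ _ hb.ne'
  have hlow : cothRatio (-Real.log q) < c := by
    have h := one_sub_exp_mul_cothRatio_lt hL
    rw [hexp] at h
    rw [hc, lt_div_iff₀ hb]
    linarith
  have hLc : -Real.log q < c := (self_lt_cothRatio hL).trans hlow
  obtain ⟨s, hs, hsc⟩ := intermediate_value_Ioo hLc.le
    (continuousOn_cothRatio.mono fun y hy => hL.trans_le hy.1)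
    ⟨hlow, self_lt_cothRatio (hL.trans hLc)⟩
  have hs0 : 0 < s := hL.trans hs.1
  have hN : 1 < s / -Real.log q := (one_lt_div hL).2 hs.1
  have hcont : ContinuousOn (phi q) (Set.Ioi 0) := fun x hx =>
    (hasDerivAt_phi hq hx).continuousAt.continuousWithinAt
  have hfac : ∀ x : ℝ, 0 < x →
      0 < -Real.log q * q ^ x * (1 + q ^ x) / (1 - q ^ x) ^ 3 := fun x hx => by
    have := Real.rpow_pos_of_pos hq.1 x
    have : 0 < 1 - q ^ x := sub_pos.2 (Real.rpow_lt_one hq.1.le hq.2 hx)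
    positivity
  refine ⟨s / -Real.log q, hN, ?_, ?_⟩
  · refine strictConcaveOn_of_deriv2_neg (convex_Icc _ _)
      (hcont.mono fun x hx => one_pos.trans_le hx.1) fun x hx => ?_
    rw [interior_Icc] at hx
    have hx0 : 0 < x := one_pos.trans hx.1
    rw [Function.iterate_succ_apply, Function.iterate_one, (hasDerivAt_deriv_phi hq hx0).deriv]
    refine mul_neg_of_pos_of_neg (hfac x hx0) (sub_neg.2 ?_)
    rw [← hbc, ← hsc]
    refine mul_lt_mul_of_pos_left (strictMonoOn_cothRatio (mul_pos hL hx0) hs0 ?_) hb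
    rw [mul_comm]
    exact (lt_div_iff₀ hL).1 hx.2
  · refine strictConvexOn_of_deriv2_pos (convex_Ici _)
      (hcont.mono fun x hx => (one_pos.trans hN).trans_le hx) fun x hx => ?_
    rw [interior_Ici] at hx
    have hx0 : 0 < x := (one_pos.trans hN).trans hx
    rw [Function.iterate_succ_apply, Function.iterate_one, (hasDerivAt_deriv_phi hq hx0).deriv]
    refine mul_pos (hfac x hx0) (sub_pos.2 ?_)
    rw [← hbc, ← hsc]
    refine mul_lt_mul_of_pos_left (strictMonoOn_cothRatio hs0 (mul_pos hL hx0) ?_) hb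
    rw [mul_comm]
    exact (div_lt_iff₀ hL).1 hx
end
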